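/- arXiv:2405.05644 — 2 statements merged into one kernel-verified Lean document; each statement's English description precedes it below -/
import Mathlib

section
/- The term S(k,h) of the mean-squared-error decomposition has a horizontal asymptote: the function k ↦ 2·k·h·βᵀ·(Z(k)·XᵀX − I)ᵀ·Z(k)·α + k²·h²·αᵀ·Z(k)ᵀ·Z(k)·α, defined for k > 0, tends to −2·h·βᵀα + h²·αᵀα as k → ∞. -/
open Matrix Filter

/-- The rescaled resolvent `k • (A + k • 1)⁻¹` of a square matrix tends to `1` as `k → ∞`. -/
theorem Matrix.tendsto_smul_inv_add_smul_one {m : Type*} [Fintype m] [DecidableEq m]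
    (A : Matrix m m ℝ) :
    Tendsto (fun k : ℝ => k • (A + k • (1 : Matrix m m ℝ))⁻¹) atTop (nhds 1) := by
  have hbase : Tendsto (fun k : ℝ => k⁻¹ • A + 1) atTop (nhds (1 : Matrix m m ℝ)) := by
    simpa using ((tendsto_inv_atTop_zero (𝕜 := ℝ)).smul_const A).add_const (1 : Matrix m m ℝ)
  have hdet : Tendsto (fun k : ℝ => (k⁻¹ • A + 1).det) atTop (nhds 1) := by
    simpa [Function.comp_def] using (continuous_id.matrix_det.tendsto (1 : Matrix m m ℝ)).comp hbase
  have hadj : Tendsto (fun k : ℝ => (k⁻¹ • A + 1).adjugate) atTop (nhds 1) := by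
    simpa [Function.comp_def] using (continuous_id.matrix_adjugate.tendsto (1 : Matrix m m ℝ)).comp hbase
  have hinv : Tendsto (fun k : ℝ => (k⁻¹ • A + 1)⁻¹) atTop (nhds (1 : Matrix m m ℝ)) := by
    simpa [Matrix.inv_def] using (hdet.inv₀ one_ne_zero).smul hadj
  refine hinv.congr' ?_
  filter_upwards [eventually_gt_atTop 0, hdet.eventually_ne one_ne_zero] with k hk hd
  have hfactor : A + k • (1 : Matrix m m ℝ) = k • (k⁻¹ • A + 1) := by
    rw [smul_add, smul_inv_smul₀ hk.ne']
  have : Invertible k := invertibleOfNonzero hk.ne'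
  rw [hfactor, Matrix.inv_smul _ k (isUnit_iff_ne_zero.mpr hd), invOf_eq_inv,
    smul_inv_smul₀ hk.ne']

/-- The resolvent `(A + k • 1)⁻¹` of a square matrix tends to `0` as `k → ∞`. -/
theorem Matrix.tendsto_inv_add_smul_one {m : Type*} [Fintype m] [DecidableEq m]
    (A : Matrix m m ℝ) :
    Tendsto (fun k : ℝ => (A + k • (1 : Matrix m m ℝ))⁻¹) atTop (nhds 0) := by
  have hlim := tendsto_inv_atTop_zero.smul A.tendsto_smul_inv_add_smul_one
  rw [zero_smul] at hlim
  refine hlim.congr' ?_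
  filter_upwards [eventually_ne_atTop 0] with k hk
  exact inv_smul_smul₀ hk _

/-- The term `S(k,h)` of the MSE decomposition has a horizontal asymptote: with
`Z(k) = (XᵀX + k·I)⁻¹`, the function
`k ↦ 2·k·h·βᵀ·(Z(k)·XᵀX − I)ᵀ·Z(k)·α + k²·h²·αᵀ·Z(k)ᵀ·Z(k)·α`
tends to `−2·h·βᵀα + h²·αᵀα` as `k → ∞`. -/
theorem S_term_tendsto {n p : ℕ}
    (X : Matrix (Fin n) (Fin p) ℝ) (β α : Fin p → ℝ) (h : ℝ) :
    Tendsto (fun k : ℝ =>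
        2 * k * h * (β ⬝ᵥ (((Xᵀ * X + k • (1 : Matrix (Fin p) (Fin p) ℝ))⁻¹ * (Xᵀ * X) - 1)ᵀ *ᵥ
            ((Xᵀ * X + k • (1 : Matrix (Fin p) (Fin p) ℝ))⁻¹ *ᵥ α)))
          + k ^ 2 * h ^ 2 * (α ⬝ᵥ (((Xᵀ * X + k • (1 : Matrix (Fin p) (Fin p) ℝ))⁻¹)ᵀ *ᵥ
              ((Xᵀ * X + k • (1 : Matrix (Fin p) (Fin p) ℝ))⁻¹ *ᵥ α))))
      atTop (nhds (-2 * h * (β ⬝ᵥ α) + h ^ 2 * (α ⬝ᵥ α))) := by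
  have hcont : Continuous fun q : Matrix (Fin p) (Fin p) ℝ × Matrix (Fin p) (Fin p) ℝ =>
      2 * h * (β ⬝ᵥ ((q.1 * (Xᵀ * X) - 1)ᵀ *ᵥ (q.2 *ᵥ α)))
        + h ^ 2 * (α ⬝ᵥ (q.2ᵀ *ᵥ (q.2 *ᵥ α))) := by
    fun_prop
  have hlim := (hcont.tendsto (0, 1)).comp
    ((Xᵀ * X).tendsto_inv_add_smul_one.prodMk_nhds (Xᵀ * X).tendsto_smul_inv_add_smul_one)
  convert hlim using 2 with k
  · simp only [Function.comp_apply, transpose_smul, smul_mulVec, mulVec_smul, dotProduct_smul,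
      smul_eq_mul]
    ring
  · simp [neg_mulVec]
end

section
/- If XᵀX is positive definite, then the function k ↦ ‖α − β̂(k,1)‖, defined on [0,∞), is monotone nonincreasing and tends to 0 as k → ∞, where β̂(k,1) = (XᵀX + k·I)⁻¹·(Xᵀy + k·α) is the penalized estimator with h = 1. -/
open Matrix Filter

/-- The Euclidean norm of a vector in `ℝᵖ`. -/
noncomputable def euclNorm {p : ℕ} (v : Fin p → ℝ) : ℝ :=
  Real.sqrt (∑ i, v i ^ 2)

theorem euclNorm_eq_sqrt_dotProduct {p : ℕ} (v : Fin p → ℝ) :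
    euclNorm v = Real.sqrt (v ⬝ᵥ v) := by
  simp [euclNorm, dotProduct, sq]

theorem dotProduct_mulVec_self_nonneg_of_posSemidef {p : ℕ} {A : Matrix (Fin p) (Fin p) ℝ}
    (hA : A.PosSemidef) (v : Fin p → ℝ) : 0 ≤ v ⬝ᵥ (A *ᵥ v) := by
  simpa using hA.dotProduct_mulVec_nonneg v

/-- The norm of the solution `v` of `(A + k) v = b` decreases as `k ≥ 0` grows. -/
theorem euclNorm_le_of_shifted_eq {p : ℕ} {A : Matrix (Fin p) (Fin p) ℝ}
    (hA : A.PosSemidef) {k l : ℝ} (hk : 0 ≤ k) (hlt : k < l) {v w : Fin p → ℝ}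
    (h : A *ᵥ w + k • w = A *ᵥ v + l • v) : euclNorm v ≤ euclNorm w := by
  rw [euclNorm_eq_sqrt_dotProduct, euclNorm_eq_sqrt_dotProduct]
  refine Real.sqrt_le_sqrt ?_
  obtain ⟨d, rfl⟩ : ∃ d, w = v + d := ⟨w - v, by simp⟩
  have hd : A *ᵥ d + k • d = (l - k) • v := by
    rw [mulVec_add, smul_add] at h
    rw [sub_smul, eq_sub_iff_add_eq]
    refine add_left_cancel (a := A *ᵥ v) ?_
    rw [← h]
    abel
  have hAd := dotProduct_mulVec_self_nonneg_of_posSemidef hA d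
  have hdd : 0 ≤ d ⬝ᵥ d := by simpa using dotProduct_star_self_nonneg d
  have key := congrArg (d ⬝ᵥ ·) hd
  simp only [dotProduct_add, dotProduct_smul, smul_eq_mul] at key
  have hdv : 0 ≤ d ⬝ᵥ v :=
    nonneg_of_mul_nonneg_right (key ▸ add_nonneg hAd (mul_nonneg hk hdd)) (sub_pos.2 hlt)
  simp only [add_dotProduct, dotProduct_add, dotProduct_comm v d]
  linarith

/-- A solution `v` of `(A + k) v = b` satisfies `‖v‖ ≤ ‖b‖ / k`. -/
theorem euclNorm_le_div_of_shifted_eq {p : ℕ} {A : Matrix (Fin p) (Fin p) ℝ}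
    (hA : A.PosSemidef) {k : ℝ} (hk : 0 < k) {v b : Fin p → ℝ}
    (h : A *ᵥ v + k • v = b) : euclNorm v ≤ euclNorm b / k := by
  rw [le_div_iff₀ hk, euclNorm_eq_sqrt_dotProduct, euclNorm_eq_sqrt_dotProduct]
  refine Real.le_sqrt_of_sq_le ?_
  have hAv := dotProduct_mulVec_self_nonneg_of_posSemidef hA v
  have hvv : 0 ≤ v ⬝ᵥ v := by simpa using dotProduct_star_self_nonneg v
  have hAA : 0 ≤ (A *ᵥ v) ⬝ᵥ (A *ᵥ v) := by simpa using dotProduct_star_self_nonneg (A *ᵥ v)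
  rw [mul_pow, Real.sq_sqrt hvv, ← h]
  simp only [add_dotProduct, dotProduct_add, dotProduct_smul, smul_dotProduct, smul_eq_mul,
    dotProduct_comm (A *ᵥ v) v]
  nlinarith [mul_nonneg hk.le hAv]

/-- The residual `v = α - (A + k)⁻¹ (c + k α)` solves `(A + k) v = A α - c`. -/
theorem shifted_mulVec_residual {p : ℕ} {A : Matrix (Fin p) (Fin p) ℝ}
    (hA : A.PosDef) {k : ℝ} (hk : 0 ≤ k) (c α : Fin p → ℝ) :
    A *ᵥ (α - (A + k • (1 : Matrix (Fin p) (Fin p) ℝ))⁻¹ *ᵥ (c + k • α)) +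
      k • (α - (A + k • (1 : Matrix (Fin p) (Fin p) ℝ))⁻¹ *ᵥ (c + k • α)) = A *ᵥ α - c := by
  have hB : (A + k • (1 : Matrix (Fin p) (Fin p) ℝ)).PosDef :=
    hA.add_posSemidef (PosSemidef.one.smul hk)
  have hdet : IsUnit (A + k • (1 : Matrix (Fin p) (Fin p) ℝ)).det :=
    (isUnit_iff_isUnit_det _).1 hB.isUnit
  have hv (v : Fin p → ℝ) :
      A *ᵥ v + k • v = (A + k • (1 : Matrix (Fin p) (Fin p) ℝ)) *ᵥ v := by
    rw [add_mulVec, smul_mulVec, one_mulVec]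
  rw [hv, mulVec_sub, mulVec_mulVec, mul_nonsing_inv _ hdet, one_mulVec, ← hv]
  abel

/-- If `XᵀX` is positive definite, then `k ↦ ‖α − β̂(k,1)‖` is monotone
nonincreasing on `[0,∞)` and tends to `0` as `k → ∞`, where
`β̂(k,1) = (XᵀX + k·I)⁻¹·(Xᵀy + k·α)` is the penalized estimator with `h = 1`. -/
theorem alpha_dist_antitone_tendsto_zero {n p : ℕ}
    (X : Matrix (Fin n) (Fin p) ℝ) (y : Fin n → ℝ) (α : Fin p → ℝ)
    (hX : (Xᵀ * X).PosDef) :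
    AntitoneOn (fun k : ℝ =>
        euclNorm (α - (Xᵀ * X + k • (1 : Matrix (Fin p) (Fin p) ℝ))⁻¹ *ᵥ (Xᵀ *ᵥ y + k • α)))
      (Set.Ici (0 : ℝ)) ∧
    Tendsto (fun k : ℝ =>
        euclNorm (α - (Xᵀ * X + k • (1 : Matrix (Fin p) (Fin p) ℝ))⁻¹ *ᵥ (Xᵀ *ᵥ y + k • α)))
      atTop (nhds 0) := by
  have hA := hX.posSemidef
  refine ⟨fun k hk l hl hkl => ?_, ?_⟩
  · rcases hkl.eq_or_lt with rfl | hlt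
    · exact le_rfl
    · exact euclNorm_le_of_shifted_eq hA hk hlt
        ((shifted_mulVec_residual hX hk _ α).trans (shifted_mulVec_residual hX hl _ α).symm)
  · refine squeeze_zero' (Eventually.of_forall fun k => Real.sqrt_nonneg _) ?_
      (tendsto_const_nhds.div_atTop tendsto_id :
        Tendsto (fun k : ℝ => euclNorm ((Xᵀ * X) *ᵥ α - Xᵀ *ᵥ y) / k) atTop (nhds 0))
    filter_upwards [eventually_gt_atTop 0] with k hk
    exact euclNorm_le_div_of_shifted_eq hA hk (shifted_mulVec_residual hX hk.le _ α)
end
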